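/- arXiv:2409.00680 — 2 statements merged into one kernel-verified Lean document; each statement's English description precedes it below -/
import Mathlib

section
/- For any integer n ≥ 0 and complex q with 0 < |q| < 1, the bilateral sum ∑_{k∈ℤ} (-1)^k q^{3k(k-1)/2} (q^{-k};q)_n (q^k;q)_n q^k equals (q;q)_∞ · q^{n(n-1)}. -/
noncomputable def qp (q x : ℂ) (n : ℕ) : ℂ := ∏ i ∈ Finset.range n, (1 - x * q ^ i)

noncomputable def qpInf (q x : ℂ) : ℂ := ∏' i : ℕ, (1 - x * q ^ i)

noncomputable def dd (q : ℂ) (k : ℤ) : ℂ := (-1 : ℂ) ^ k * q ^ (3 * (k * (k - 1) / 2))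

theorem tri_succ (k : ℤ) : (k + 1) * (k + 1 - 1) / 2 = k * (k - 1) / 2 + k := by
  have : (k + 1) * (k + 1 - 1) = k * (k - 1) + k * 2 := by ring
  rw [this, Int.add_mul_ediv_right _ _ (by norm_num)]

theorem tri_neg (k : ℤ) : (-k) * (-k - 1) / 2 = k * (k - 1) / 2 + k := by
  rw [← tri_succ]; congr 1; ring

theorem tri_refl (k : ℤ) : (1 - k) * (1 - k - 1) / 2 = k * (k - 1) / 2 := by
  congr 1; ring

theorem dd_succ {q : ℂ} (hq : q ≠ 0) (k : ℤ) : dd q (k + 1) = - dd q k * q ^ (3 * k) := by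
  unfold dd
  rw [tri_succ, mul_add, zpow_add₀ hq, zpow_add₀ (by norm_num)]
  ring

theorem dd_neg {q : ℂ} (hq : q ≠ 0) (k : ℤ) : dd q (-k) = dd q k * q ^ (3 * k) := by
  unfold dd
  rw [tri_neg, mul_add, zpow_add₀ hq, zpow_neg, ← inv_zpow]
  norm_num
  ring

theorem dd_refl {q : ℂ} (k : ℤ) : dd q (1 - k) = - dd q k := by
  unfold dd
  rw [tri_refl, sub_eq_add_neg, zpow_add₀ (by norm_num), zpow_neg, ← inv_zpow]
  norm_num

theorem dd_ne {q : ℂ} (hq : q ≠ 0) (k : ℤ) : dd q k ≠ 0 := by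
  unfold dd
  exact mul_ne_zero (zpow_ne_zero _ (by norm_num)) (zpow_ne_zero _ hq)

def Good (q : ℂ) (p : ℤ → ℂ) : Prop := ∀ j : ℤ, Summable fun k : ℤ => dd q k * q ^ (j * k) * p k

theorem ratio_aux {q : ℂ} (hq : q ≠ 0) (h1 : ‖q‖ < 1) (c : ℂ) (f : ℕ → ℂ) (hf : ∀ n, f n ≠ 0)
    (h : ∀ n, f (n + 1) = f n * (c * (q ^ 3) ^ n)) : Summable f := by
  refine summable_of_ratio_test_tendsto_lt_one (l := 0) one_pos (.of_forall hf) ?_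
  have h2 : ∀ n, ‖f (n + 1)‖ / ‖f n‖ = ‖c * (q ^ 3) ^ n‖ := fun n => by
    rw [h, norm_mul, mul_div_cancel_left₀ _ (norm_ne_zero_iff.2 (hf n))]
  simp_rw [h2]
  have h3 : ‖q ^ 3‖ < 1 := by
    rw [norm_pow]; exact pow_lt_one₀ (norm_nonneg _) h1 (by norm_num)
  have := (tendsto_pow_atTop_nhds_zero_of_norm_lt_one h3).const_mul c
  simpa using this.norm

theorem good_one {q : ℂ} (hq : q ≠ 0) (h1 : ‖q‖ < 1) : Good q (fun _ => 1) := by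
  intro j
  apply Summable.of_nat_of_neg
  · apply ratio_aux hq h1 (- q ^ j)
    · intro n
      exact mul_ne_zero (mul_ne_zero (dd_ne hq _) (zpow_ne_zero _ hq)) one_ne_zero
    · intro n
      push_cast
      rw [dd_succ hq, mul_add, zpow_add₀ hq, zpow_mul q 3]
      simp only [zpow_natCast, zpow_ofNat]
      ring
  · apply ratio_aux hq h1 (- q ^ 3 * q ^ (-j))
    · intro n
      exact mul_ne_zero (mul_ne_zero (dd_ne hq _) (zpow_ne_zero _ hq)) one_ne_zero
    · intro n
      push_cast
      rw [dd_neg hq, dd_neg hq, dd_succ hq, show j * -((n : ℤ) + 1) = j * -n + -j by ring,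
        zpow_add₀ hq, mul_add 3, zpow_add₀ hq, zpow_mul q 3]
      simp only [zpow_natCast, zpow_ofNat, mul_one]
      ring

theorem good_mul {q : ℂ} (hq : q ≠ 0) {p : ℤ → ℂ} (hp : Good q p) (a b : ℂ) (i : ℤ) :
    Good q (fun k => p k * (a + b * q ^ (i * k))) := by
  intro j
  refine (((hp j).mul_left a).add ((hp (j + i)).mul_left b)).congr fun k => ?_
  rw [add_mul j i, zpow_add₀ hq]; ring

theorem good_qp {q : ℂ} (hq : q ≠ 0) {p : ℤ → ℂ} (hp : Good q p) (c : ℂ) (i : ℤ) (n : ℕ) :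
    Good q (fun k => p k * qp q (c * q ^ (i * k)) n) := by
  induction n with
  | zero => simpa [qp] using hp
  | succ n ih =>
    have := good_mul hq ih 1 (- c * q ^ n) i
    convert this using 2 with k
    simp only [qp, Finset.prod_range_succ]
    ring

theorem qp_succ (q x : ℂ) (n : ℕ) : qp q x (n + 1) = qp q x n * (1 - x * q ^ n) := by
  simp [qp, Finset.prod_range_succ]

theorem qp_succ' (q x : ℂ) (n : ℕ) : qp q x (n + 1) = (1 - x) * qp q (x * q) n := by
  simp only [qp, Finset.prod_range_succ', pow_succ]
  rw [mul_comm]; simp [mul_assoc, mul_comm q]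

noncomputable def AA (q : ℂ) (n : ℕ) (k : ℤ) : ℂ := qp q (q ^ (-k)) n * qp q (q ^ k) n
noncomputable def BB (q : ℂ) (n : ℕ) (k : ℤ) : ℂ := qp q (q ^ (1 - k)) n * qp q (q ^ k) n
noncomputable def CC (q : ℂ) (n : ℕ) (k : ℤ) : ℂ := qp q (q ^ (1 - k)) n * qp q (q ^ (1 + k)) n

theorem AA_neg (q : ℂ) (n : ℕ) (k : ℤ) : AA q n (-k) = AA q n k := by
  simp [AA, mul_comm]
theorem CC_neg (q : ℂ) (n : ℕ) (k : ℤ) : CC q n (-k) = CC q n k := by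
  simp [CC, mul_comm, sub_eq_add_neg]
theorem BB_refl (q : ℂ) (n : ℕ) (k : ℤ) : BB q n (1 - k) = BB q n k := by
  simp [BB, mul_comm]

theorem AA_succ {q : ℂ} (hq : q ≠ 0) (n : ℕ) (k : ℤ) :
    AA q (n + 1) k = AA q n k * ((1 - (q ^ k)⁻¹ * q ^ n) * (1 - q ^ k * q ^ n)) := by
  simp only [AA, qp_succ, zpow_neg]; ring

theorem AA_BB {q : ℂ} (hq : q ≠ 0) (n : ℕ) (k : ℤ) :
    AA q (n + 1) k = BB q n k * ((1 - (q ^ k)⁻¹) * (1 - q ^ k * q ^ n)) := by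
  unfold AA BB
  rw [qp_succ' q (q ^ (-k)), qp_succ q (q ^ k), ← zpow_add_one₀ hq, neg_add_eq_sub, zpow_neg]
  ring

theorem AA_BB' {q : ℂ} (hq : q ≠ 0) (n : ℕ) (k : ℤ) :
    AA q (n + 1) (1 - k) = BB q n k * ((1 - q ^ k / q) * (1 - q * (q ^ k)⁻¹ * q ^ n)) := by
  unfold AA BB
  rw [qp_succ' q (q ^ (-(1 - k))), qp_succ q (q ^ (1 - k)), ← zpow_add_one₀ hq, neg_sub,
    sub_add_cancel, zpow_sub_one₀ hq, zpow_sub₀ hq, zpow_one]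
  field_simp

theorem BB_CC {q : ℂ} (hq : q ≠ 0) (n : ℕ) (k : ℤ) :
    CC q n k * (1 - q ^ k) = BB q n k * (1 - q ^ k * q ^ n) := by
  unfold CC BB
  rw [mul_assoc, mul_assoc, ← qp_succ, qp_succ', ← zpow_add_one₀ hq, add_comm 1 k]
  ring

theorem AA_good {q : ℂ} (hq : q ≠ 0) (h1 : ‖q‖ < 1) (n : ℕ) : Good q (AA q n) := by
  have := good_qp hq (good_qp hq (good_one hq h1) 1 (-1) n) 1 1 n
  convert this using 2 with k
  simp [AA]

theorem CC_good {q : ℂ} (hq : q ≠ 0) (h1 : ‖q‖ < 1) (n : ℕ) : Good q (CC q n) := by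
  have := good_qp hq (good_qp hq (good_one hq h1) q (-1) n) q 1 n
  convert this using 2 with k
  simp [CC, sub_eq_add_neg, zpow_add₀ hq]

theorem tsum_anti_neg (g : ℤ → ℂ) (h : ∀ k, g (-k) = - g k) : ∑' k, g k = 0 := by
  have := (Equiv.neg ℤ).tsum_eq g
  simp only [Equiv.neg_apply, h, tsum_neg] at this
  exact self_eq_neg.1 this.symm

theorem tsum_anti_refl (g : ℤ → ℂ) (h : ∀ k, g (1 - k) = - g k) : ∑' k, g k = 0 := by
  have := (Equiv.subLeft (1 : ℤ)).tsum_eq g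
  simp only [Equiv.subLeft_apply, h, tsum_neg] at this
  exact self_eq_neg.1 this.symm

noncomputable def FF (q : ℂ) (n : ℕ) (k : ℤ) : ℂ := dd q k * q ^ k * AA q n k

theorem FF_summable {q : ℂ} (hq : q ≠ 0) (h1 : ‖q‖ < 1) (n : ℕ) : Summable (FF q n) := by
  refine (AA_good hq h1 n 1).congr fun k => ?_
  simp [FF]

theorem decomp {q : ℂ} (f g h : ℤ → ℂ) (hf : Summable f) (hg : Summable g)
    (hfg : ∀ k, f k = g k + h k) (h1 : ∀ k, g (-k) = - g k) (h2 : ∀ k, h (1 - k) = - h k) :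
    ∑' k, f k = 0 := by
  have hh : Summable h := (hf.sub hg).congr fun k => by rw [hfg]; ring
  simp_rw [hfg]
  rw [hg.tsum_add hh, tsum_anti_neg g h1, tsum_anti_refl h h2, add_zero]

theorem neg_sym {q : ℂ} (hq : q ≠ 0) (k : ℤ) :
    dd q (-k) * q ^ (-k) * (1 - q ^ (-k)) = - (dd q k * q ^ k * (1 - q ^ k)) := by
  have := zpow_ne_zero k hq
  rw [dd_neg hq, mul_comm 3 k, zpow_mul, zpow_neg, zpow_ofNat]
  field_simp
  ring

theorem FF_diff {q : ℂ} (hq : q ≠ 0) (h1 : ‖q‖ < 1) (n : ℕ) :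
    ∑' k, (FF q (n + 1) k - q ^ (2 * n) * FF q n k) = 0 := by
  have hs : Summable fun k => FF q (n + 1) k - q ^ (2 * n) * FF q n k :=
    (FF_summable hq h1 _).sub ((FF_summable hq h1 _).mul_left _)
  cases n with
  | zero =>
    refine decomp (q := q) _ (fun k => dd q k * q ^ k * (1 - q ^ k)) (fun k => - dd q k) hs ?_ ?_
      (fun k => neg_sym hq k) (fun k => by rw [dd_refl])
    · have := good_mul hq (good_one hq h1) 1 (-1) 1 1
      simpa [sub_eq_add_neg] using this
    · intro k
      have := zpow_ne_zero k hq
      simp only [FF, AA, qp]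
      simp
      field_simp
      ring
  | succ m =>
    refine decomp (q := q) _
      (fun k => dd q k * q ^ k * (1 - q ^ k) *
        (q ^ (m + 1) * AA q (m + 1) k + (1 - q ^ (m + 1)) * CC q m k))
      (fun k => dd q k * (- q ^ (m + 1) * (AA q (m + 1) k + AA q (m + 1) (1 - k)) / 2
        + (1 - q ^ (m + 1)) * q ^ (m + 1) * BB q m k * (q ^ (k - 1) + q ^ (- k)) / 2
        - (1 - q ^ (m + 1)) * BB q m k)) hs ?_ ?_ ?_ ?_
    · have a1 := (good_mul hq (AA_good hq h1 (m + 1)) 1 (-1) 1 1).mul_left (q ^ (m + 1))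
      have a2 := (good_mul hq (CC_good hq h1 m) 1 (-1) 1 1).mul_left (1 - q ^ (m + 1))
      refine (a1.add a2).congr fun k => ?_
      simp only [one_mul]
      ring
    · intro k
      have hk := zpow_ne_zero k hq
      simp only [FF]
      rw [AA_succ hq (m + 1)]
      have e : ∀ x : ℂ, dd q k * q ^ k * (1 - q ^ k) * (q ^ (m + 1) * x +
          (1 - q ^ (m + 1)) * CC q m k) = dd q k * q ^ k * (1 - q ^ k) * (q ^ (m + 1) * x) +
          dd q k * q ^ k * (1 - q ^ (m + 1)) * (CC q m k * (1 - q ^ k)) := fun x => by ring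
      rw [e, BB_CC hq, AA_BB hq, AA_BB' hq, zpow_sub_one₀ hq, zpow_neg]
      generalize q ^ k = u at *
      field_simp
      ring
    · intro k
      rw [AA_neg, CC_neg, neg_sym hq]
      ring
    · intro k
      rw [dd_refl, BB_refl, sub_sub_cancel, show 1 - k - 1 = -k by ring,
        show -(1 - k) = k - 1 by ring]
      ring

theorem FF_tsum {q : ℂ} (hq : q ≠ 0) (h1 : ‖q‖ < 1) (n : ℕ) :
    ∑' k, FF q n k = (∑' k, FF q 0 k) * q ^ (n * (n - 1)) := by
  induction n with
  | zero => simp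
  | succ n ih =>
    have := FF_diff hq h1 n
    rw [(FF_summable hq h1 _).tsum_sub ((FF_summable hq h1 _).mul_left _), tsum_mul_left,
      sub_eq_zero, ih] at this
    rw [this, mul_left_comm, ← pow_add]
    congr 2
    cases n <;> simp
    ring

theorem prod_bound {q : ℂ} (h1 : ‖q‖ < 1) : ∃ C : ℝ, ∀ k n : ℕ,
    ‖∏ i ∈ Finset.range n, (1 - q ^ (k + i + 1))‖ ≤ C := by
  refine ⟨Real.exp (∑' i : ℕ, ‖q‖ ^ i), fun k n => ?_⟩
  rw [norm_prod]
  calc ∏ i ∈ Finset.range n, ‖1 - q ^ (k + i + 1)‖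
      ≤ ∏ i ∈ Finset.range n, Real.exp (‖q‖ ^ i) := by
        refine Finset.prod_le_prod (fun _ _ => norm_nonneg _) fun i _ => ?_
        calc ‖1 - q ^ (k + i + 1)‖ ≤ 1 + ‖q‖ ^ (k + i + 1) := by
              simpa using norm_sub_le (1 : ℂ) (q ^ (k + i + 1))
          _ ≤ 1 + ‖q‖ ^ i := by
              gcongr 1 + ?_
              exact pow_le_pow_of_le_one (norm_nonneg _) h1.le (by omega)
          _ ≤ _ := by rw [add_comm]; exact Real.add_one_le_exp _
    _ = Real.exp (∑ i ∈ Finset.range n, ‖q‖ ^ i) := (Real.exp_sum _ _).symm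
    _ ≤ _ := Real.exp_le_exp.2 ((summable_geometric_of_lt_one (norm_nonneg _) h1).sum_le_tsum _
        (fun _ _ => by positivity))

theorem FF_zero {q : ℂ} (hq : q ≠ 0) (k : ℤ) : FF q 0 k = (-1) ^ k * q ^ pentagonal k := by
  simp only [FF, AA, qp, dd, Finset.range_zero, Finset.prod_empty, mul_one]
  rw [mul_assoc, ← zpow_add₀ hq, ← zpow_natCast q (pentagonal k)]
  congr 2
  have h2 := two_mul_natCast_pentagonal k
  have h3 : 2 * (k * (k - 1) / 2) = k * (k - 1) :=
    Int.two_mul_ediv_two_of_even (Int.even_mul_pred_self k)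
  linarith

theorem penta {q : ℂ} (hq : q ≠ 0) (h1 : ‖q‖ < 1) : ∑' k, FF q 0 k = qpInf q q := by
  have hsum := (FF_summable hq h1 0).hasSum
  have hs2 : HasSum (fun k : ℕ ↦ (-1) ^ k * (q ^ pentagonal (-k) - q ^ pentagonal (k + 1)))
      (∑' k, FF q 0 k) := by
    rw [← neg_injective.hasSum_iff (fun x hx ↦ by absurd hx; use -x; simp)] at hsum
    convert hsum.nat_add_neg_add_one using 2 with k
    simp only [Function.comp_apply, neg_neg, FF_zero hq, zpow_neg, ← inv_zpow]
    rw [zpow_add₀ (by norm_num)]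
    simp
    ring
  obtain ⟨C, hC⟩ := prod_bound h1
  have hb : ∀ k n : ℕ, ‖q ^ ((k + 1) * n) * ∏ i ∈ Finset.range (n + 1), (1 - q ^ (k + i + 1))‖
      ≤ ‖q‖ ^ n * C := fun k n => by
    rw [norm_mul, norm_pow]
    refine mul_le_mul ?_ (hC _ _) (norm_nonneg _) (by positivity)
    exact pow_le_pow_of_le_one (norm_nonneg _) h1.le (by nlinarith)
  have hg := (summable_geometric_of_lt_one (norm_nonneg _) h1).mul_right C
  have := Pentagonal.tprod_one_sub_pow (x := q) ?_ ?_ ?_ hs2.summable ?_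
  · rw [hs2.tsum_eq] at this
    rw [← this, qpInf]
    simp_rw [pow_succ']
  · exact tendsto_pow_atTop_nhds_zero_of_norm_lt_one h1
  · exact fun k => Summable.of_norm_bounded hg (hb k)
  · intro k
    simp_rw [sub_eq_add_neg]
    apply multipliable_one_add_of_summable
    simp only [norm_neg, norm_pow, add_assoc]
    exact (summable_nat_add_iff (k + 1)).2 (summable_geometric_of_lt_one (norm_nonneg _) h1)
  · have ht := ((tendsto_pow_atTop_nhds_zero_of_lt_one (norm_nonneg q) h1)).mul_const
      (∑' n : ℕ, ‖q‖ ^ n * C)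
    rw [zero_mul] at ht
    refine squeeze_zero_norm (fun k => ?_) ht
    rw [norm_mul, norm_mul, norm_pow, norm_pow]
    simp only [norm_neg, norm_one, one_pow, one_mul]
    refine mul_le_mul ?_ (tsum_of_norm_bounded hg.hasSum (hb k)) (norm_nonneg _) (by positivity)
    apply pow_le_pow_of_le_one (norm_nonneg _) h1.le
    rw [Nat.le_div_iff_mul_le (by norm_num)]
    nlinarith

theorem stmt0 (q : ℂ) (h0 : 0 < ‖q‖) (h1 : ‖q‖ < 1) (n : ℕ) :
    ∑' k : ℤ, (-1 : ℂ) ^ k * q ^ (3 * (k * (k - 1) / 2)) *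
        qp q (q ^ (-k)) n * qp q (q ^ k) n * q ^ k
      = qpInf q q * q ^ (n * (n - 1)) := by
  have hq : q ≠ 0 := norm_pos_iff.1 h0
  rw [← penta hq h1, ← FF_tsum hq h1]
  refine tsum_congr fun k => ?_
  simp only [FF, AA, dd]
  ring
end

section
/- For any integer n ≥ 0, ∑_{k=0}^{n} [2n choose k+n]_q · (-1)^k q^{k(k-1)/2} (1 - q^k) H(k) = (q;q)_∞ (q^n − 1) q^{n(n-1)}, where H(k) = ∑_{j∈ℤ} (-1)^j q^{3j(j-1)/2} (1 - q^j) q^{(1+k)j} and [m choose r]_q is the Gaussian binomial coefficient. -/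
noncomputable def qbinom (q : ℂ) (m r : ℕ) : ℂ :=
  if r ≤ m then qp q q m / (qp q q r * qp q q (m - r)) else 0

noncomputable def H (q : ℂ) (n : ℤ) : ℂ :=
  ∑' k : ℤ, (-1 : ℂ) ^ k * q ^ (3 * (k * (k - 1) / 2)) * (1 - q ^ k) * q ^ ((1 + n) * k)


open Filter Topology

namespace Aux4

noncomputable def tau (q : ℂ) (k : ℤ) : ℂ := (-1 : ℂ) ^ k * q ^ (k * (k - 1) / 2)

lemma tau_succ {q : ℂ} (hq : q ≠ 0) (k : ℤ) : tau q (k + 1) = -q ^ k * tau q k := by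
  unfold tau
  have h : (k + 1) * (k + 1 - 1) / 2 = k * (k - 1) / 2 + k := by
    rw [← Int.add_mul_ediv_right _ _ (by norm_num : (2 : ℤ) ≠ 0)]; congr 1; ring
  rw [h, zpow_add₀ hq, zpow_add₀ (by norm_num : (-1 : ℂ) ≠ 0)]
  ring

lemma tau_neg {q : ℂ} (hq : q ≠ 0) (k : ℤ) : tau q (-k) = q ^ k * tau q k := by
  unfold tau
  have h : (-k) * (-k - 1) / 2 = k * (k - 1) / 2 + k := by
    rw [← Int.add_mul_ediv_right _ _ (by norm_num : (2 : ℤ) ≠ 0)]; congr 1; ring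
  have h2 : (-1 : ℂ) ^ (-k) = (-1 : ℂ) ^ k := by
    rw [zpow_neg, ← inv_zpow]; norm_num
  rw [h, zpow_add₀ hq, h2]
  ring

lemma tau_nat (q : ℂ) (k : ℕ) : (-1 : ℂ) ^ k * q ^ (k * (k - 1) / 2) = tau q k := by
  unfold tau
  rw [zpow_natCast]
  congr 1
  rw [← zpow_natCast]
  congr 1
  cases k <;> simp

/-- The recursively defined transform. -/
noncomputable def T (q : ℂ) (f : ℤ → ℂ) : ℕ → ℤ → ℤ → ℂ
  | 0, _, b => f b
  | n + 1, y, b => (1 + q ^ (2 * (n : ℤ) + 1)) * T q f n y b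
      - q ^ ((n : ℤ) + 1 - y) * T q f n y (b - 1) - q ^ ((n : ℤ) + y) * T q f n y (b + 1)

lemma T_sym (q : ℂ) (f : ℤ → ℂ) (hf : ∀ a, f (3 - a) = f a) (n : ℕ) (y b : ℤ) :
    T q f n (1 - y) (3 - b) = T q f n y b := by
  induction n generalizing b with
  | zero => exact hf b
  | succ n ih =>
    simp only [T]
    have h1 := ih (b + 1)
    have h2 := ih (b - 1)
    rw [show 3 - (b + 1) = 3 - b - 1 by ring] at h1
    rw [show 3 - (b - 1) = 3 - b + 1 by ring] at h2
    rw [ih b, h1, h2]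
    rw [show (n : ℤ) + 1 - (1 - y) = n + y by ring, show (n : ℤ) + (1 - y) = n + 1 - y by ring]
    ring

lemma T_per {q : ℂ} (hq : q ≠ 0) (f : ℤ → ℂ) (hf : ∀ a, f (a + 3) = -q ^ (-a) * f a)
    (n : ℕ) (y b : ℤ) :
    T q f n y (b + 3) = -q ^ (-b) * T q f n (y - 1) b := by
  induction n generalizing b with
  | zero => exact hf b
  | succ n ih =>
    simp only [T]
    have h1 := ih (b + 1)
    have h2 := ih (b - 1)
    rw [show b + 1 + 3 = b + 3 + 1 by ring] at h1
    rw [show b - 1 + 3 = b + 3 - 1 by ring] at h2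
    rw [ih b, h1, h2]
    have e1 : q ^ ((n : ℤ) + 1 - y) * q ^ (-(b - 1)) = q ^ (-b) * q ^ ((n : ℤ) + 1 - (y - 1)) := by
      rw [← zpow_add₀ hq, ← zpow_add₀ hq]; congr 1; ring
    have e2 : q ^ ((n : ℤ) + y) * q ^ (-(b + 1)) = q ^ (-b) * q ^ ((n : ℤ) + (y - 1)) := by
      rw [← zpow_add₀ hq, ← zpow_add₀ hq]; congr 1; ring
    linear_combination T q f n (y - 1) (b - 1) * e1 + T q f n (y - 1) (b + 1) * e2

lemma T_M {q : ℂ} (hq : q ≠ 0) (f : ℤ → ℂ) (n : ℕ) (y b : ℤ) :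
    q ^ (n : ℤ) * T q f n y b - q ^ (y - 1) * T q f n y (b + 1)
      = T q f n (y - 1) b - q ^ (y + n - 1) * T q f n (y - 1) (b + 1) := by
  induction n generalizing b with
  | zero => simp [T]
  | succ n ih =>
    simp only [T]
    have h0 := ih b
    have h1 := ih (b + 1)
    have h2 := ih (b - 1)
    rw [show b - 1 + 1 = b by ring] at h2
    rw [show b + 1 - 1 = b by ring]
    obtain ⟨Y, hY⟩ : ∃ Y, Y = q ^ y := ⟨_, rfl⟩
    obtain ⟨N, hN⟩ : ∃ N, N = q ^ (n : ℤ) := ⟨_, rfl⟩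
    have hY0 : Y ≠ 0 := hY ▸ zpow_ne_zero _ hq
    have hN0 : N ≠ 0 := hN ▸ zpow_ne_zero _ hq
    have e1 : q ^ (2 * (n : ℤ) + 1) = N ^ 2 * q := by
      rw [zpow_add₀ hq, mul_comm (2 : ℤ), zpow_mul, ← hN]; norm_cast; ring
    push_cast
    simp only [zpow_add₀ hq, zpow_sub₀ hq, zpow_one, ← hY, ← hN] at *
    rw [e1]
    field_simp at h0 h1 h2 ⊢
    linear_combination (1 + q ^ 2 * N ^ 2) * Y * h0 - N * q ^ 2 * h2 - Y ^ 2 * N * h1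

lemma T_main {q : ℂ} (hq : q ≠ 0) (f : ℤ → ℂ) (hs : ∀ a, f (3 - a) = f a)
    (hp : ∀ a, f (a + 3) = -q ^ (-a) * f a) (n : ℕ) :
    T q f n 0 1 = q ^ n * T q f n 0 2 ∧ T q f n 0 2 = q ^ (n * (n - 1)) * f 2 := by
  have key : ∀ n, T q f n 0 1 = q ^ n * T q f n 0 2 := by
    intro n
    have h := T_M hq f n 1 1
    have s1 := T_sym q f hs n 0 1
    have s2 := T_sym q f hs n 0 2
    norm_num at h s1 s2
    rw [s1, s2] at h
    linear_combination -h / 2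
  refine ⟨key n, ?_⟩
  induction n with
  | zero => simp [T]
  | succ n ih =>
    have s1 := T_sym q f hs n 0 0
    have s2 := T_sym q f hs n 0 2
    have s3 := T_sym q f hs n 0 3
    have p := T_per hq f hp n 1 0
    have m := T_M hq f n 1 0
    have k := key n
    norm_num at s1 s2 s3 p m
    have z : T q f n 0 0 = 0 := by
      linear_combination -s1 / 2 + p / 2
    rw [s2, s3, z] at m
    have e1 : q ^ (2 * (n : ℤ) + 1) = q ^ (2 * n + 1) := by norm_cast
    have e2 : q ^ ((n : ℤ) + 1 - 0) = q ^ (n + 1) := by rw [sub_zero]; norm_cast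
    have e3 : q ^ ((n : ℤ) + 0) = q ^ n := by rw [add_zero]; norm_cast
    simp only [T]
    rw [e1, e2, e3]
    norm_num
    have e4 : q ^ ((n + 1) * n) = q ^ (2 * n) * q ^ (n * (n - 1)) := by
      rw [← pow_add]; congr 1; cases n
      · simp
      · simp; ring
    rw [e4, mul_assoc, ← ih]
    rw [k] at m ⊢
    linear_combination -m

/-- inverse q-factorial, zero at negative integers -/
noncomputable def g (q : ℂ) (m : ℤ) : ℂ := if m < 0 then 0 else (qp q q m.toNat)⁻¹

lemma one_sub_ne {q : ℂ} (h1 : ‖q‖ < 1) (m : ℕ) : 1 - q * q ^ m ≠ 0 := by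
  intro h
  have : q ^ (m + 1) = 1 := by rw [pow_succ']; linear_combination -h
  have h2 : ‖q‖ ^ (m + 1) = 1 := by rw [← norm_pow, this, norm_one]
  have := pow_lt_one₀ (norm_nonneg q) h1 (Nat.succ_ne_zero m)
  simp at this; linarith

lemma g_rec {q : ℂ} (h1 : ‖q‖ < 1) (m : ℤ) : g q (m - 1) = (1 - q ^ m) * g q m := by
  unfold g
  rcases lt_trichotomy m 0 with h | h | h
  · rw [if_pos (by omega), if_pos h]; simp
  · subst h; simp
  · obtain ⟨k, rfl⟩ : ∃ k : ℕ, m = k + 1 := ⟨(m - 1).toNat, by omega⟩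
    rw [if_neg (by omega), if_neg (by omega)]
    have a1 : ((k : ℤ) + 1 - 1).toNat = k := by omega
    have a2 : ((k : ℤ) + 1).toNat = k + 1 := by omega
    rw [a1, a2]
    unfold qp
    rw [Finset.prod_range_succ, mul_inv]
    have := one_sub_ne h1 k
    have e : q ^ ((k : ℤ) + 1) = q * q ^ k := by norm_cast; ring
    rw [e]
    field_simp

noncomputable def c (q : ℂ) (n : ℕ) (k : ℤ) : ℂ := qp q q (2 * n) * g q (n + k) * g q (n - k)

lemma c_rec {q : ℂ} (hq : q ≠ 0) (h1 : ‖q‖ < 1) (n : ℕ) (k : ℤ) :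
    c q (n + 1) k = (1 + q ^ (2 * (n : ℤ) + 1)) * c q n k + q ^ ((n : ℤ) + 1 + k) * c q n (k + 1)
      + q ^ ((n : ℤ) + 1 - k) * c q n (k - 1) := by
  unfold c
  have a1 := g_rec h1 (n + 1 + k)
  have a2 := g_rec h1 (n + k)
  have b1 := g_rec h1 (n + 1 - k)
  have b2 := g_rec h1 (n - k)
  rw [show (n : ℤ) + 1 + k - 1 = n + k by ring] at a1
  rw [show (n : ℤ) + 1 - k - 1 = n - k by ring] at b1
  rw [show (n : ℤ) + k - 1 = n + (k - 1) by ring] at a2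
  rw [show (n : ℤ) - k - 1 = n - (k + 1) by ring] at b2
  rw [show (n : ℤ) + (k + 1) = n + 1 + k by ring, show (n : ℤ) - (k - 1) = n + 1 - k by ring,
    a2, b2, a1, b1]
  have hP : qp q q (2 * (n + 1)) = qp q q (2 * n) * (1 - q * q ^ (2 * n)) *
      (1 - q * q ^ (2 * n + 1)) := by
    unfold qp
    rw [show 2 * (n + 1) = 2 * n + 1 + 1 by ring, Finset.prod_range_succ, Finset.prod_range_succ]
  rw [hP]
  push_cast
  obtain ⟨K, hK⟩ : ∃ Y, Y = q ^ k := ⟨_, rfl⟩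
  obtain ⟨N, hN⟩ : ∃ N, N = q ^ n := ⟨_, rfl⟩
  have hK0 : K ≠ 0 := hK ▸ zpow_ne_zero _ hq
  have e1 : q ^ (2 * (n : ℤ) + 1) = N ^ 2 * q := by
    rw [zpow_add₀ hq, mul_comm (2 : ℤ), zpow_mul, zpow_natCast, ← hN]; norm_cast; ring
  have e2 : q ^ (2 * n) = N ^ 2 := by rw [hN]; ring
  rw [pow_succ q (2 * n), e1, e2]
  simp only [zpow_add₀ hq, zpow_sub₀ hq, zpow_one, zpow_natCast, ← hK, ← hN]
  field_simp
  ring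

lemma c_neg (q : ℂ) (n : ℕ) (k : ℤ) : c q n (-k) = c q n k := by
  unfold c
  rw [sub_neg_eq_add, ← sub_eq_add_neg]; ring

lemma c_zero_of {q : ℂ} (n : ℕ) (k : ℤ) (h : k ∉ Finset.Icc (-(n : ℤ)) n) : c q n k = 0 := by
  unfold c g
  simp only [Finset.mem_Icc, not_and_or, not_le] at h
  rcases h with h | h
  · rw [if_pos (by omega)]; simp
  · rw [if_pos (by omega : (n : ℤ) - k < 0)]; simp

lemma c_nat (q : ℂ) (n k : ℕ) (h : k ≤ n) : c q n k = qbinom q (2 * n) (k + n) := by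
  unfold c g qbinom
  rw [if_neg (by omega), if_neg (by omega), if_pos (by omega)]
  rw [show ((n : ℤ) + k).toNat = k + n by omega, show ((n : ℤ) - k).toNat = 2 * n - (k + n) by omega]
  rw [div_eq_mul_inv, mul_inv, mul_assoc]

lemma c_summable (q : ℂ) (n : ℕ) (F : ℤ → ℂ) : Summable fun k => c q n k * F k := by
  apply summable_of_ne_finset_zero (s := Finset.Icc (-(n : ℤ)) n)
  intro b hb
  rw [c_zero_of n b hb, zero_mul]

lemma T_eq {q : ℂ} (hq : q ≠ 0) (h1 : ‖q‖ < 1) (f : ℤ → ℂ) (n : ℕ) (y b : ℤ) :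
    T q f n y b = ∑' k : ℤ, c q n k * (tau q k * q ^ (y * k) * f (b + k)) := by
  induction n generalizing b with
  | zero =>
    rw [tsum_eq_single 0]
    · simp [T, c, g, qp, tau]
    · intro k hk
      rw [c_zero_of, zero_mul]
      simp; omega
  | succ n ih =>
    simp only [T]
    rw [ih, ih, ih]
    rw [← (Equiv.addRight (1 : ℤ)).tsum_eq (fun k : ℤ => c q n k * (tau q k * q ^ (y * k) * f (b - 1 + k))),
      ← (Equiv.subRight (1 : ℤ)).tsum_eq (fun k : ℤ => c q n k * (tau q k * q ^ (y * k) * f (b + 1 + k)))]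
    have s0 := (c_summable q n fun k => tau q k * q ^ (y * k) * f (b + k)).mul_left
      (1 + q ^ (2 * (n : ℤ) + 1))
    have s1 := ((Equiv.addRight (1 : ℤ)).summable_iff.mpr
      (c_summable q n fun k => tau q k * q ^ (y * k) * f (b - 1 + k))).mul_left
      (q ^ ((n : ℤ) + 1 - y))
    have s2 := ((Equiv.subRight (1 : ℤ)).summable_iff.mpr
      (c_summable q n fun k => tau q k * q ^ (y * k) * f (b + 1 + k))).mul_left
      (q ^ ((n : ℤ) + y))
    rw [← tsum_mul_left, ← tsum_mul_left, ← tsum_mul_left, ← Summable.tsum_sub, ← Summable.tsum_sub]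
    · refine tsum_congr fun k => ?_
      simp only [Equiv.coe_addRight, Equiv.subRight_apply]
      rw [c_rec hq h1, show b - 1 + (k + 1) = b + k by ring, show b + 1 + (k - 1) = b + k by ring,
        tau_succ hq]
      have t := tau_succ hq (k - 1)
      rw [sub_add_cancel] at t
      have e1 : q ^ ((n : ℤ) + 1 + k) * q ^ (y * k) =
          q ^ ((n : ℤ) + 1 - y) * q ^ k * q ^ (y * (k + 1)) := by
        simp only [← zpow_add₀ hq]; congr 1; ring
      have e2 : q ^ ((n : ℤ) + 1 - k) * q ^ (y * k) * q ^ (k - 1) =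
          q ^ ((n : ℤ) + y) * q ^ (y * (k - 1)) := by
        simp only [← zpow_add₀ hq]; congr 1; ring
      rw [t]
      linear_combination c q n (k + 1) * q ^ (k - 1) * tau q (k - 1) * f (b + k) * e1
        + c q n (k - 1) * tau q (k - 1) * f (b + k) * e2
    · exact s0.sub s1
    · exact s2
    · exact s0
    · exact s1

end Aux4
namespace Aux4

lemma T_final {q : ℂ} (hq : q ≠ 0) (h1 : ‖q‖ < 1) (f : ℤ → ℂ) (hs : ∀ a, f (3 - a) = f a)
    (hp : ∀ a, f (a + 3) = -q ^ (-a) * f a) (n : ℕ) :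
    ∑ k ∈ Finset.range (n + 1), c q n k * (tau q k * (1 - q ^ (k : ℤ)) * (f (1 + k) - f (2 + k)))
      = f 2 * (q ^ n - 1) * q ^ (n * (n - 1)) := by
  set F : ℤ → ℂ := fun k => tau q k * (1 - q ^ k) * (f (1 + k) - f (2 + k)) with hF
  have Fneg : ∀ k, F (-k) = F k := by
    intro k
    simp only [hF]
    rw [tau_neg hq, show 1 + -k = 3 - (2 + k) by ring, show 2 + -k = 3 - (1 + k) by ring, hs, hs,
      zpow_neg]
    have := zpow_ne_zero k hq
    field_simp
    ring
  have hN : HasSum (fun k : ℕ => c q n k * F k) (∑ k ∈ Finset.range (n + 1), c q n k * F k) := by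
    apply hasSum_sum_of_ne_finset_zero
    intro k hk
    rw [c_zero_of, zero_mul]
    simp at hk ⊢; omega
  have hN' : HasSum (fun k : ℕ => c q n (-(k : ℤ)) * F (-(k : ℤ)))
      (∑ k ∈ Finset.range (n + 1), c q n k * F k) := by
    simpa only [c_neg, Fneg] using hN
  have hZ := (HasSum.of_nat_of_neg (f := fun k : ℤ => c q n k * F k) hN hN').tsum_eq
  have F0 : F 0 = 0 := by simp [hF]
  have e : ∑' k : ℤ, c q n k * F k =
      (T q f n 0 1 - T q f n 1 1) - (T q f n 0 2 - T q f n 1 2) := by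
    simp only [T_eq hq h1]
    rw [← (c_summable q n _).tsum_sub (c_summable q n _),
      ← (c_summable q n _).tsum_sub (c_summable q n _),
      ← ((c_summable q n _).sub (c_summable q n _)).tsum_sub
        ((c_summable q n _).sub (c_summable q n _))]
    refine tsum_congr fun k => ?_
    simp only [hF, zero_mul, one_mul, zpow_zero]
    ring
  have s1 := T_sym q f hs n 0 1
  have s2 := T_sym q f hs n 0 2
  norm_num at s1 s2
  obtain ⟨m1, m2⟩ := T_main hq f hs hp n
  rw [e, s1, s2, F0] at hZ
  rw [m2] at m1
  rw [m1, m2] at hZ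
  linear_combination -hZ / 2

noncomputable def tm (q : ℂ) (a j : ℤ) : ℂ := (-1 : ℂ) ^ j * q ^ (3 * (j * (j - 1) / 2) + a * j)

noncomputable def th (q : ℂ) (a : ℤ) : ℂ := ∑' j : ℤ, tm q a j

lemma two_half (j : ℤ) : 2 * (j * (j - 1) / 2) = j * (j - 1) := by
  exact Int.mul_ediv_cancel' (Int.even_mul_pred_self j).two_dvd

lemma tm_summable {q : ℂ} (hq : q ≠ 0) (h1 : ‖q‖ < 1) (a : ℤ) : Summable (tm q a) := by
  have h0 : 0 < ‖q‖ := norm_pos_iff.mpr hq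
  have hr : Summable fun j : ℤ => ‖q‖ ^ j.natAbs := by
    apply Summable.of_nat_of_neg
    · simpa using summable_geometric_of_lt_one h0.le h1
    · simpa using summable_geometric_of_lt_one h0.le h1
  refine Summable.of_norm_bounded (hr.mul_left (‖q‖ ^ (-(|a| + 3) ^ 2))) fun j => ?_
  unfold tm
  rw [norm_mul, norm_zpow, norm_zpow, norm_neg, norm_one, one_zpow, one_mul,
    ← zpow_natCast, ← zpow_add₀ h0.ne']
  apply zpow_le_zpow_right_of_le_one₀ h0 h1.le
  have h := two_half j
  have b : -( |a| * |j|) ≤ a * j := by rw [← abs_mul]; exact neg_abs_le _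
  have hj : j * j = |j| * |j| := (abs_mul_abs_self j).symm
  have : j ≤ |j| := le_abs_self j
  have ha := abs_nonneg a
  have hj0 := abs_nonneg j
  rw [Int.natCast_natAbs]
  nlinarith [sq_nonneg (|j| - (|a| + 3)), sq_nonneg (|j|)]

lemma th_per {q : ℂ} (hq : q ≠ 0) (a : ℤ) : th q (a + 3) = -q ^ (-a) * th q a := by
  unfold th
  rw [← (Equiv.addRight (1 : ℤ)).tsum_eq (tm q a), ← tsum_mul_left]
  refine tsum_congr fun j => ?_
  simp only [Equiv.coe_addRight, tm]
  rw [zpow_add₀ (by norm_num : (-1 : ℂ) ≠ 0)]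
  have : q ^ (3 * (j * (j - 1) / 2) + (a + 3) * j) =
      q ^ (-a) * q ^ (3 * ((j + 1) * (j + 1 - 1) / 2) + a * (j + 1)) := by
    rw [← zpow_add₀ hq]; congr 1
    have := two_half j
    have := two_half (j + 1)
    linarith
  rw [this]; ring

lemma th_sym {q : ℂ} (a : ℤ) : th q (3 - a) = th q a := by
  unfold th
  rw [← (Equiv.neg ℤ).tsum_eq (tm q a)]
  refine tsum_congr fun j => ?_
  simp only [Equiv.neg_apply, tm]
  congr 1
  · rw [zpow_neg, ← inv_zpow]; norm_num
  · congr 1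
    have := two_half j
    have := two_half (-j)
    linarith

lemma H_eq {q : ℂ} (hq : q ≠ 0) (h1 : ‖q‖ < 1) (k : ℤ) : H q k = th q (1 + k) - th q (2 + k) := by
  unfold H th
  rw [← (tm_summable hq h1 _).tsum_sub (tm_summable hq h1 _)]
  refine tsum_congr fun j => ?_
  unfold tm
  rw [show (2 + k) * j = (1 + k) * j + j by ring]
  simp only [zpow_add₀ hq]
  ring

lemma prod_bound {q : ℂ} (h1 : ‖q‖ < 1) (k n : ℕ) :
    ‖∏ i ∈ Finset.range (n + 1), (1 - q ^ (k + i + 1))‖ ≤ Real.exp (1 - ‖q‖)⁻¹ := by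
  rw [norm_prod]
  calc ∏ i ∈ Finset.range (n + 1), ‖1 - q ^ (k + i + 1)‖
      ≤ ∏ i ∈ Finset.range (n + 1), (1 + ‖q‖ ^ i) := by
        apply Finset.prod_le_prod
        · intros; positivity
        · intro i _
          refine (norm_sub_le _ _).trans ?_
          rw [norm_one, norm_pow]
          have := pow_le_pow_of_le_one (norm_nonneg q) h1.le (by omega : i ≤ k + i + 1)
          linarith
    _ ≤ Real.exp (∑ i ∈ Finset.range (n + 1), ‖q‖ ^ i) :=
        Real.prod_one_add_le_exp_sum _ (fun i => by positivity)
    _ ≤ _ := by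
        apply Real.exp_le_exp.mpr
        rw [← tsum_geometric_of_lt_one (norm_nonneg q) h1]
        exact (summable_geometric_of_lt_one (norm_nonneg q) h1).sum_le_tsum _
          (fun i _ => by positivity)

lemma th_two {q : ℂ} (hq : q ≠ 0) (h1 : ‖q‖ < 1) : th q 2 = qpInf q q := by
  have h0 : 0 < ‖q‖ := norm_pos_iff.mpr hq
  have hgeo := summable_geometric_of_lt_one (norm_nonneg q) h1
  have hp : ∀ k : ℕ, tm q 2 k = (-1) ^ k * q ^ pentagonal (-k) := by
    intro k
    unfold tm
    rw [zpow_natCast, ← zpow_natCast q]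
    congr 2
    have := two_half k
    have := two_mul_natCast_pentagonal_neg k
    linarith
  have hn : ∀ k : ℕ, tm q 2 (-(k + 1)) = -((-1) ^ k * q ^ pentagonal (k + 1)) := by
    intro k
    unfold tm
    have : (-1 : ℂ) ^ (-((k : ℤ) + 1)) = -(-1) ^ k := by
      rw [zpow_neg, ← inv_zpow, zpow_add₀ (by norm_num)]; norm_num
    rw [this, ← zpow_natCast q, neg_mul]
    congr 3
    have := two_half (-((k : ℤ) + 1))
    have := two_mul_natCast_pentagonal (k + 1)
    linarith
  have hs := tm_summable hq h1 2
  have sp : Summable fun k : ℕ => tm q 2 k := hs.comp_injective Nat.cast_injective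
  have sn : Summable fun k : ℕ => tm q 2 (-(k + 1)) :=
    hs.comp_injective (i := fun k : ℕ => -((k : ℤ) + 1)) (fun a b h => by simpa using h)
  have bd : ∀ k n : ℕ, ‖q ^ ((k + 1) * n) * ∏ i ∈ Finset.range (n + 1), (1 - q ^ (k + i + 1))‖ ≤
      ‖q‖ ^ n * Real.exp (1 - ‖q‖)⁻¹ := by
    intro k n
    rw [norm_mul, norm_pow]
    apply mul_le_mul _ (prod_bound h1 k n) (norm_nonneg _) (by positivity)
    exact pow_le_pow_of_le_one h0.le h1.le (by nlinarith)
  have main := Pentagonal.tprod_one_sub_pow (x := q)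
    (tendsto_pow_atTop_nhds_zero_of_norm_lt_one h1)
    (fun k => Summable.of_norm_bounded (hgeo.mul_right _) (bd k))
    (fun k => by
      simp only [sub_eq_add_neg]
      apply multipliable_one_add_of_summable
      simp only [norm_neg, norm_pow]
      have := (summable_nat_add_iff (k + 1)).mpr hgeo
      simpa [add_assoc] using this)
    (by
      have := sp.add sn
      simp only [hp, hn] at this
      refine this.congr fun k => ?_
      ring)
    (by
      have z := (tendsto_pow_atTop_nhds_zero_of_norm_lt_one (x := ‖q‖) (by simpa using h1)).mul_const
        (∑' n : ℕ, ‖q‖ ^ n * Real.exp (1 - ‖q‖)⁻¹)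
      rw [zero_mul] at z
      refine squeeze_zero_norm (fun k => ?_) z
      rw [norm_mul, norm_mul, norm_pow, norm_pow, norm_neg, norm_one, one_pow, one_mul]
      apply mul_le_mul _ _ (norm_nonneg _) (by positivity)
      · apply pow_le_pow_of_le_one h0.le h1.le
        rw [Nat.le_div_iff_mul_le (by norm_num)]
        nlinarith
      · exact tsum_of_norm_bounded (hgeo.mul_right _).hasSum (bd k))
  unfold th qpInf
  rw [tsum_of_nat_of_neg_add_one sp sn, ← sp.tsum_add sn]
  have e : ∀ i : ℕ, 1 - q * q ^ i = 1 - q ^ (i + 1) := fun i => by rw [pow_succ']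
  simp only [e]
  rw [main]
  refine tsum_congr fun k => ?_
  rw [hp, hn]; ring

end Aux4

theorem stmt4 (q : ℂ) (h0 : 0 < ‖q‖) (h1 : ‖q‖ < 1) (n : ℕ) :
    ∑ k ∈ Finset.range (n + 1),
        qbinom q (2 * n) (k + n) * (-1 : ℂ) ^ k * q ^ (k * (k - 1) / 2) * (1 - q ^ k) * H q k
      = qpInf q q * (q ^ n - 1) * q ^ (n * (n - 1)) := by
  have hq : q ≠ 0 := norm_pos_iff.mp h0
  rw [← Aux4.th_two hq h1, ← Aux4.T_final hq h1 (Aux4.th q) Aux4.th_sym (Aux4.th_per hq) n]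
  refine Finset.sum_congr rfl fun k hk => ?_
  rw [Aux4.c_nat q n k (by simp at hk; omega), ← Aux4.tau_nat, Aux4.H_eq hq h1, zpow_natCast]
  ring
end
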